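/- Let S = {0, 1, −1, X, −X, X+1, −(X+1), 2*X+1, −(2*X+1)} ⊆ ℤ[X]. If n ≥ 3 and M is an n×n matrix over ℤ[X] that is a forbidden minor for S, then det M lies in the set {2, X−1, X+2, 2*X, 2*X+2, 3*X+1, 3*X+2, 4*X+2} ∪ {−2, −(X−1), −(X+2), −2*X, −(2*X+2), −(3*X+1), −(3*X+2), −(4*X+2)}. -/

import Mathlib

open Polynomial Matrix

/-- `M` is totally `S`-modular: every `k × k` subdeterminant (taken along strictly
monotone row/column selections) lies in `S`, for all `1 ≤ k ≤ min m n`. -/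
def IsTotallySModular {R : Type*} [CommRing R] {m n : ℕ}
    (S : Set R) (M : Matrix (Fin m) (Fin n) R) : Prop :=
  ∀ k : ℕ, 1 ≤ k → k ≤ min m n →
    ∀ f : Fin k → Fin m, ∀ g : Fin k → Fin n, StrictMono f → StrictMono g →
      (M.submatrix f g).det ∈ S

/-- An `l × l` matrix (`l ≥ 2`) is a forbidden minor for `S` if every
`(l-1) × (l-1)` submatrix is totally `S`-modular but its determinant is not in `S`. -/
def IsForbiddenMinor {R : Type*} [CommRing R] {l : ℕ}
    (S : Set R) (M : Matrix (Fin l) (Fin l) R) : Prop :=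
  2 ≤ l ∧
  (∀ f : Fin (l - 1) → Fin l, ∀ g : Fin (l - 1) → Fin l,
      StrictMono f → StrictMono g → IsTotallySModular S (M.submatrix f g)) ∧
  M.det ∉ S

/-- The Jacobi identity for the leading block
of the adjugate of a block matrix. -/
theorem det_mul_det_toBlocks₁₁_adjugate {p q R : Type*} [Fintype p] [Fintype q] [DecidableEq p]
    [DecidableEq q] [CommRing R] (N : Matrix (p ⊕ q) (p ⊕ q) R) :
    N.det * N.adjugate.toBlocks₁₁.det = N.det ^ Fintype.card p * N.toBlocks₂₂.det := by
  have hB := N.mul_adjugate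
  rw [← fromBlocks_toBlocks N, ← fromBlocks_toBlocks (adjugate _), fromBlocks_multiply,
    ← fromBlocks_one, fromBlocks_smul, fromBlocks_inj] at hB
  obtain ⟨h₁, -, h₂, -⟩ := hB
  have key : N * fromBlocks N.adjugate.toBlocks₁₁ 0 N.adjugate.toBlocks₂₁ 1 =
      fromBlocks (N.det • 1) N.toBlocks₁₂ 0 N.toBlocks₂₂ := by
    conv_lhs => rw [← fromBlocks_toBlocks N]
    rw [fromBlocks_multiply]
    simp only [fromBlocks_toBlocks] at h₁ h₂ ⊢
    rw [h₁, h₂]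
    simp
  have := congrArg det key
  rwa [det_mul, det_fromBlocks_zero₁₂, det_fromBlocks_zero₂₁, det_one, mul_one, det_smul, det_one,
    mul_one] at this

/-- Two rows of the adjugate of a nonsingular matrix have a nonzero `2 × 2` minor. -/
theorem exists_adjugate_minor_ne_zero {ι R : Type*} [Fintype ι] [DecidableEq ι] [CommRing R]
    [IsDomain R] (N : Matrix ι ι R) (hN : N.det ≠ 0) {i i' : ι} (hi : i ≠ i') :
    ∃ j j', N.adjugate i j * N.adjugate i' j' - N.adjugate i j' * N.adjugate i' j ≠ 0 := by
  by_contra! h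
  have hsum (a b : ι) : ∑ j, N.adjugate a j * N j b = if a = b then N.det else 0 := by
    have := congrFun (congrFun N.adjugate_mul a) b
    simpa [mul_apply, one_apply] using this
  have hzero (j' : ι) : N.adjugate i' j' = 0 := by
    have h0 : N.det * N.adjugate i' j' = 0 := by
      calc N.det * N.adjugate i' j'
          = (∑ j, N.adjugate i j * N j i) * N.adjugate i' j' := by rw [hsum, if_pos rfl]
        _ = N.adjugate i j' * ∑ j, N.adjugate i' j * N j i := by
            rw [Finset.sum_mul, Finset.mul_sum]
            refine Finset.sum_congr rfl fun j _ => ?_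
            linear_combination N j i * h j j'
        _ = 0 := by rw [hsum, if_neg hi.symm, mul_zero]
    exact (mul_eq_zero.mp h0).resolve_left hN
  apply hN
  have := hsum i' i'
  simpa [hzero] using this.symm

/-- Reordering an injective row selection changes the minor only by a sign. -/
theorem abs_det_submatrix_le_of_injective {k m n : ℕ} {c : ℤ} {N : Matrix (Fin m) (Fin n) ℤ}
    {g : Fin k → Fin n}
    (h : ∀ f : Fin k → Fin m, StrictMono f → |(N.submatrix f g).det| ≤ c)
    {f : Fin k → Fin m} (hf : Function.Injective f) : |(N.submatrix f g).det| ≤ c := by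
  have hs : StrictMono (f ∘ Tuple.sort f) :=
    (Tuple.monotone_sort f).strictMono_of_injective (hf.comp (Tuple.sort f).injective)
  have hdet := det_permute (Tuple.sort f) (N.submatrix f g)
  have := h _ hs
  rw [show N.submatrix (f ∘ Tuple.sort f) g = (N.submatrix f g).submatrix (Tuple.sort f) id from
    rfl, hdet, abs_mul] at this
  rcases Int.units_eq_one_or (Equiv.Perm.sign (Tuple.sort f)) with h1 | h1 <;>
    simpa [h1] using this

/-- An integer matrix whose minors of corank one and two lie in `{-1, 0, 1}` has determinant
at most two in absolute value. -/
theorem abs_det_le_two {m : ℕ} (N : Matrix (Fin (m + 2)) (Fin (m + 2)) ℤ)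
    (h₁ : ∀ i j, |N.adjugate i j| ≤ 1)
    (h₂ : ∀ f g : Fin m → Fin (m + 2), StrictMono f → StrictMono g →
      |(N.submatrix f g).det| ≤ 1) : |N.det| ≤ 2 := by
  by_cases hN : N.det = 0
  · simp [hN]
  let e : Fin 2 ⊕ Fin m ≃ Fin (m + 2) := finSumFinEquiv.trans (finCongr (add_comm 2 m))
  have he : StrictMono (e ∘ Sum.inr) := fun a b hab => by
    change 2 + (a : ℕ) < 2 + (b : ℕ)
    exact Nat.add_lt_add_left hab 2
  let i := e (Sum.inl 0)
  let i' := e (Sum.inl 1)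
  have hi : i ≠ i' := by simp [i, i']
  obtain ⟨j, j', hj⟩ := exists_adjugate_minor_ne_zero N hN hi
  have hjj : j ≠ j' := by
    rintro rfl
    exact hj (sub_self _)
  obtain ⟨σ, hσ, hσ'⟩ : ∃ σ : Equiv.Perm (Fin (m + 2)), σ i = j ∧ σ i' = j' := by
    have hne : Equiv.swap i j i' ≠ j := by
      intro h
      rw [← Equiv.swap_apply_left i j] at h
      exact hi ((Equiv.swap i j).injective h).symm
    refine ⟨(Equiv.swap i j).trans (Equiv.swap (Equiv.swap i j i') j'), ?_, ?_⟩
    · simp [Equiv.swap_apply_of_ne_of_ne hne.symm hjj]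
    · simp
  let N' : Matrix (Fin 2 ⊕ Fin m) (Fin 2 ⊕ Fin m) ℤ := N.submatrix (e.trans σ) e
  have hsign : N'.det = Equiv.Perm.sign σ * N.det := by
    have := det_permute σ N
    rw [← det_submatrix_equiv_self e] at this
    simpa [N'] using this
  have hadj : N'.adjugate = (Equiv.Perm.sign σ : ℤ) • N.adjugate.submatrix e (e.trans σ) := by
    have hN' : N'.det ≠ 0 := by
      rw [hsign]
      exact mul_ne_zero (Units.ne_zero _) hN
    have hmul : N' * ((Equiv.Perm.sign σ : ℤ) • N.adjugate.submatrix e (e.trans σ)) =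
        N'.det • 1 := by
      rw [Matrix.mul_smul, submatrix_mul_equiv, mul_adjugate, hsign]
      rw [submatrix_smul, Pi.smul_apply, Pi.smul_apply, submatrix_one_equiv, smul_smul]
    have heq := N'.mul_adjugate.trans hmul.symm
    have := congrArg (N'.adjugate * ·) heq
    simp only [← Matrix.mul_assoc, adjugate_mul, smul_mul, Matrix.one_mul] at this
    exact smul_right_injective _ hN' this
  have hblock := det_mul_det_toBlocks₁₁_adjugate N'
  have hminor : |N'.toBlocks₂₂.det| ≤ 1 := by
    refine abs_det_submatrix_le_of_injective (N := N) (f := σ ∘ e ∘ Sum.inr)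
      (g := e ∘ Sum.inr) (fun f hf => h₂ f _ hf he) ?_
    exact σ.injective.comp he.injective
  have hleading : N'.adjugate.toBlocks₁₁.det =
      N.adjugate i j * N.adjugate i' j' - N.adjugate i j' * N.adjugate i' j := by
    have hsq : (Equiv.Perm.sign σ : ℤ) * Equiv.Perm.sign σ = 1 := by
      rcases Int.units_eq_one_or (Equiv.Perm.sign σ) with h | h <;> simp [h]
    rw [det_fin_two, hadj]
    change _ * N.adjugate i (σ i) * (_ * N.adjugate i' (σ i')) -
      _ * N.adjugate i (σ i') * (_ * N.adjugate i' (σ i)) = _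
    rw [hσ, hσ']
    linear_combination
      (N.adjugate i j * N.adjugate i' j' - N.adjugate i j' * N.adjugate i' j) * hsq
  have hdet : |N'.det| = |N.det| := by
    rcases Int.units_eq_one_or (Equiv.Perm.sign σ) with h | h <;> simp [hsign, h]
  have hcancel : N'.adjugate.toBlocks₁₁.det = N'.det * N'.toBlocks₂₂.det := by
    have hN' : N'.det ≠ 0 := by rw [← abs_ne_zero, hdet, abs_ne_zero]; exact hN
    apply mul_left_cancel₀ hN'
    rw [hblock, Fintype.card_fin]
    ring
  rw [hleading] at hcancel
  have hminor_pos : 1 ≤ |N'.toBlocks₂₂.det| := by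
    refine Int.one_le_abs fun h => hj ?_
    rw [hcancel, h, mul_zero]
  have hbound : |N.adjugate i j * N.adjugate i' j' - N.adjugate i j' * N.adjugate i' j| ≤ 2 := by
    have hprod (a b c d) : |N.adjugate a b * N.adjugate c d| ≤ 1 := by
      rw [abs_mul]
      exact mul_le_one₀ (h₁ _ _) (abs_nonneg _) (h₁ _ _)
    linarith [abs_sub (N.adjugate i j * N.adjugate i' j') (N.adjugate i j' * N.adjugate i' j),
      hprod i j i' j', hprod i j' i' j]
  rwa [hcancel, abs_mul, le_antisymm hminor hminor_pos, mul_one, hdet] at hbound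

/-- A matrix of size at least three whose adjugate has entries of degree at most one has
determinant of degree at most one. -/
theorem natDegree_det_le_one {n : ℕ} (hn : 3 ≤ n) {R : Type*} [CommRing R] [IsDomain R]
    (M : Matrix (Fin n) (Fin n) R[X]) (h : ∀ i j, (M.adjugate i j).natDegree ≤ 1) :
    M.det.natDegree ≤ 1 := by
  have hdeg : M.adjugate.det.natDegree ≤ n := by
    rw [det_apply]
    refine natDegree_sum_le_of_forall_le _ _ fun σ _ => ?_
    rw [Units.smul_def, zsmul_eq_mul]
    refine natDegree_mul_le.trans ?_
    rw [natDegree_intCast, zero_add]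
    refine (natDegree_prod_le _ _).trans
      ((Finset.sum_le_card_nsmul _ _ 1 fun i _ => h _ _).trans ?_)
    simp
  rw [det_adjugate, natDegree_pow, Fintype.card_fin] at hdeg
  by_contra! hlt
  obtain ⟨k, rfl⟩ := Nat.exists_eq_add_of_le hn
  have : (3 + k - 1) * 2 ≤ (3 + k - 1) * M.det.natDegree := Nat.mul_le_mul_left _ hlt
  omega

/-- A strictly monotone selection that misses one more index factors through `Fin.succAbove`. -/
theorem exists_succAbove_comp_of_strictMono {k : ℕ} (f : Fin k → Fin (k + 2)) (hf : StrictMono f) :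
    ∃ (p : Fin (k + 2)) (e : Fin k → Fin (k + 1)), StrictMono e ∧ f = p.succAbove ∘ e := by
  obtain ⟨p, hp⟩ : ∃ p, ∀ a, f a ≠ p := by
    by_contra! hsurj
    have := Fintype.card_le_of_surjective f hsurj
    simp at this
  choose e he using fun a => Fin.exists_succAbove_eq (hp a)
  refine ⟨p, e, fun a b hab => ?_, funext fun a => (he a).symm⟩
  rw [← (Fin.strictMono_succAbove p).lt_iff_lt, he, he]
  exact hf hab

theorem stmt12 {n : ℕ} (hn : 3 ≤ n) (M : Matrix (Fin n) (Fin n) (Polynomial ℤ))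
    (hM : IsForbiddenMinor
      ({0, 1, -1, X, -X, X + 1, -(X + 1), 2 * X + 1, -(2 * X + 1)} : Set (Polynomial ℤ)) M) :
    M.det ∈ ({2, X - 1, X + 2, 2 * X, 2 * X + 2, 3 * X + 1, 3 * X + 2, 4 * X + 2} ∪
      {-2, -(X - 1), -(X + 2), -(2 * X), -(2 * X + 2), -(3 * X + 1), -(3 * X + 2),
        -(4 * X + 2)} : Set (Polynomial ℤ)) := by
  obtain ⟨-, hsub, hdet⟩ := hM
  set S : Set (Polynomial ℤ) :=
    {0, 1, -1, X, -X, X + 1, -(X + 1), 2 * X + 1, -(2 * X + 1)} with hS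
  have hdegS : ∀ p ∈ S, p.natDegree ≤ 1 := by
    rintro p (rfl | rfl | rfl | rfl | rfl | rfl | rfl | rfl | rfl) <;> compute_degree!
  have hneg : ∀ p ∈ S, -p ∈ S := by
    rintro p (rfl | rfl | rfl | rfl | rfl | rfl | rfl | rfl | rfl) <;> simp [hS]
  have hevalS : ∀ x : ℤ, x = 0 ∨ x = -1 → ∀ p ∈ S, |p.eval x| ≤ 1 := by
    rintro x (rfl | rfl) p (rfl | rfl | rfl | rfl | rfl | rfl | rfl | rfl | rfl) <;> norm_num
  obtain ⟨m, rfl⟩ : ∃ m, n = m + 2 := ⟨n - 2, by omega⟩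
  have hminor₁ (i j : Fin (m + 2)) : (M.submatrix i.succAbove j.succAbove).det ∈ S :=
    hsub i.succAbove j.succAbove (Fin.strictMono_succAbove i) (Fin.strictMono_succAbove j)
      (m + 1) (by omega) (by simp) id id strictMono_id strictMono_id
  have hminor₂ (f g : Fin m → Fin (m + 2)) (hf : StrictMono f) (hg : StrictMono g) :
      (M.submatrix f g).det ∈ S := by
    obtain ⟨p, a, ha, rfl⟩ := exists_succAbove_comp_of_strictMono f hf
    obtain ⟨q, b, hb, rfl⟩ := exists_succAbove_comp_of_strictMono g hg
    exact hsub p.succAbove q.succAbove (Fin.strictMono_succAbove p) (Fin.strictMono_succAbove q)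
      m (by omega) (by simp) a b ha hb
  have hadj (i j : Fin (m + 2)) : M.adjugate i j ∈ S := by
    rw [adjugate_fin_succ_eq_det_submatrix]
    rcases neg_one_pow_eq_or (Polynomial ℤ) (j + i : ℕ) with h | h <;> rw [h]
    · simpa using hminor₁ j i
    · simpa using hneg _ (hminor₁ j i)
  have hdeg := natDegree_det_le_one hn M fun i j => hdegS _ (hadj i j)
  have heval (x : ℤ) (hx : x = 0 ∨ x = -1) : |M.det.eval x| ≤ 2 := by
    let N := (evalRingHom x).mapMatrix M
    have hN : M.det.eval x = N.det := RingHom.map_det (evalRingHom x) M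
    have hNadj (i j) : |N.adjugate i j| ≤ 1 := by
      rw [← RingHom.map_adjugate]
      exact hevalS x hx _ (hadj i j)
    have hNminor (f g : Fin m → Fin (m + 2)) (hf : StrictMono f) (hg : StrictMono g) :
        |(N.submatrix f g).det| ≤ 1 := by
      have := hevalS x hx _ (hminor₂ f g hf hg)
      rwa [← coe_evalRingHom, RingHom.map_det] at this
    rw [hN]
    exact abs_det_le_two N hNadj hNminor
  obtain ⟨a, b, hab⟩ := exists_eq_X_add_C_of_natDegree_le_one hdeg
  have h0 := heval 0 (Or.inl rfl)
  have h1 := heval (-1) (Or.inr rfl)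
  rw [hab] at h0 h1 hdet ⊢
  simp only [eval_add, eval_mul, eval_C, eval_X, mul_zero, zero_add, mul_neg_one, abs_le] at h0 h1
  obtain ⟨hb, hb'⟩ := h0
  obtain ⟨ha, ha'⟩ : b - 2 ≤ a ∧ a ≤ b + 2 := by omega
  simp only [hS, Set.mem_union, Set.mem_insert_iff, Set.mem_singleton_iff, eq_intCast]
    at hdet ⊢
  interval_cases b <;> interval_cases a <;> push_cast at hdet ⊢ <;> grind
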